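/- For every real θ, the operator R = R_I(θ) on V^{⊗3}, V = ℂ², is a unitary matrix and is a generalized Yang-Baxter operator of type (2,3,1): it is invertible, satisfies (R⊗Id_V)∘(Id_V⊗R)∘(R⊗Id_V) = (Id_V⊗R)∘(R⊗Id_V)∘(Id_V⊗R) on V^{⊗4}, and satisfies far-commutativity (R⊗Id_V^{⊗(j−2)})∘(Id_V^{⊗(j−2)}⊗R) = (Id_V^{⊗(j−2)}⊗R)∘(R⊗Id_V^{⊗(j−2)}) for all j ≥ 4. -/

import Mathlib

open scoped BigOperators
open Matrix

/-- Endomorphisms of `V^{⊗n}`, `dim V = d`, as multi-indexed matrices. -/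
abbrev MIM (d n : ℕ) := Matrix (Fin n → Fin d) (Fin n → Fin d) ℂ

/-- Kronecker (tensor) product of multi-indexed matrices. -/
noncomputable def mtens {d a b : ℕ} (f : MIM d a) (g : MIM d b) : MIM d (a + b) :=
  fun i j =>
    f (fun x => i (Fin.castAdd b x)) (fun x => j (Fin.castAdd b x)) *
    g (fun x => i (Fin.natAdd a x)) (fun x => j (Fin.natAdd a x))

/-- Partial operator trace `Sp_{p+m,m}` over the last `m` tensor factors. -/
noncomputable def pTr {d : ℕ} (p m : ℕ) (f : MIM d (p + m)) : MIM d p :=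
  fun i j => ∑ l : Fin m → Fin d, f (Fin.append i l) (Fin.append j l)

/-- Kronecker power `μ^{⊗ n}`. -/
noncomputable def mpow {d : ℕ} (μ : Matrix (Fin d) (Fin d) ℂ) (n : ℕ) : MIM d n :=
  fun i j => ∏ x : Fin n, μ (i x) (j x)

/-- Transport a multi-indexed matrix along an equality of the number of factors. -/
noncomputable def recast {d a b : ℕ} (h : a = b) (f : MIM d a) : MIM d b :=
  Matrix.reindex (Equiv.arrowCongr (finCongr h) (Equiv.refl (Fin d)))
    (Equiv.arrowCongr (finCongr h) (Equiv.refl (Fin d))) f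

/-- `R_i = I_m^{⊗(i-1)} ⊗ R ⊗ I_m^{⊗(n-i-1)}` acting on `V^{⊗(k+m(n-2))}`
(zero-based index `i : Fin (n-1)`). -/
noncomputable def Rop (d k m n : ℕ) (R : MIM d k) (i : Fin (n - 1)) : MIM d (k + m * (n - 2)) :=
  fun a b =>
    if ∀ x : Fin (k + m * (n - 2)),
        ((x : ℕ) < m * (i : ℕ) ∨ m * (i : ℕ) + k ≤ (x : ℕ)) → a x = b x then
      R (fun y => a ⟨m * (i : ℕ) + (y : ℕ), by
            have h1 : (i : ℕ) < n - 1 := i.isLt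
            have h2 : m * (i : ℕ) ≤ m * (n - 2) := Nat.mul_le_mul_left m (by omega)
            have h3 := y.isLt
            omega⟩)
        (fun y => b ⟨m * (i : ℕ) + (y : ℕ), by
            have h1 : (i : ℕ) < n - 1 := i.isLt
            have h2 : m * (i : ℕ) ≤ m * (n - 2) := Nat.mul_le_mul_left m (by omega)
            have h3 := y.isLt
            omega⟩)
    else 0

/-- `R` is a generalized Yang–Baxter operator of type `(d,k,m)`. -/
def IsGYB (d k m : ℕ) (R : MIM d k) : Prop :=
  IsUnit R ∧
  (Rop d k m 3 R 0 * Rop d k m 3 R 1 * Rop d k m 3 R 0 =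
      Rop d k m 3 R 1 * Rop d k m 3 R 0 * Rop d k m 3 R 1) ∧
  ∀ j : ℕ, (hj : 4 ≤ j) →
    Rop d k m j R ⟨0, by omega⟩ * Rop d k m j R ⟨j - 2, by omega⟩ =
      Rop d k m j R ⟨j - 2, by omega⟩ * Rop d k m j R ⟨0, by omega⟩

/-- Defining relations of the braid group `B_n` (zero-based generators). -/
def braidRels (n : ℕ) : Set (FreeGroup (Fin (n - 1))) :=
  { r | (∃ i j : Fin (n - 1), (i : ℕ) + 2 ≤ (j : ℕ) ∧
          r = FreeGroup.of i * FreeGroup.of j * (FreeGroup.of i)⁻¹ * (FreeGroup.of j)⁻¹) ∨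
        (∃ i j : Fin (n - 1), (j : ℕ) = (i : ℕ) + 1 ∧
          r = FreeGroup.of i * FreeGroup.of j * FreeGroup.of i *
              (FreeGroup.of j * FreeGroup.of i * FreeGroup.of j)⁻¹) }

/-- The braid group `B_n` as a presented group. -/
abbrev BraidGroup (n : ℕ) := PresentedGroup (braidRels n)

/-- Lexicographic identification of `(Fin 3 → Fin 2)` with `Fin 8`. -/
def emb (v : Fin 3 → Fin 2) : Fin 8 :=
  ⟨4 * (v 0 : ℕ) + 2 * (v 1 : ℕ) + (v 2 : ℕ), by
    have := (v 0).isLt; have := (v 1).isLt; have := (v 2).isLt; omega⟩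

/-- View an `8×8` matrix as an endomorphism of `(ℂ²)^{⊗3}` via the
lexicographically ordered basis. -/
def ofMat8 (M : Matrix (Fin 8) (Fin 8) ℂ) : MIM 2 3 :=
  fun a b => M (emb a) (emb b)

/-- The `(2,3,1)` operator of type I. -/
noncomputable def RI (θ : ℝ) : MIM 2 3 :=
  ofMat8 <| ((Real.sqrt 2 : ℂ))⁻¹ •
    (Matrix.reindex finSumFinEquiv finSumFinEquiv <| Matrix.fromBlocks
      !![1, 0, 1, 0;
         0, Complex.I, 0, Complex.exp (θ * Complex.I);
         -Complex.I, 0, Complex.I, 0;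
         0, -Complex.I * Complex.exp (-θ * Complex.I), 0, 1] 0 0
      !![Complex.I, 0, Complex.exp (θ * Complex.I), 0;
         0, 1, 0, -Complex.exp (2 * θ * Complex.I);
         -Complex.I * Complex.exp (-θ * Complex.I), 0, 1, 0;
         0, Complex.I * Complex.exp (-2 * θ * Complex.I), 0, Complex.I])

/-- The `(2,3,1)` operator of type II. -/
noncomputable def RII (θ : ℝ) : MIM 2 3 :=
  ofMat8 <| ((Real.sqrt 2 : ℂ))⁻¹ •
    (Matrix.reindex finSumFinEquiv finSumFinEquiv <| Matrix.fromBlocks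
      !![1, 0, 1, 0;
         0, Complex.I, 0, Complex.exp (θ * Complex.I);
         -1, 0, 1, 0;
         0, Complex.exp (-θ * Complex.I), 0, Complex.I] 0 0
      !![Complex.I, 0, Complex.exp (θ * Complex.I), 0;
         0, 1, 0, -Complex.exp (2 * θ * Complex.I);
         Complex.exp (-θ * Complex.I), 0, Complex.I, 0;
         0, Complex.exp (-2 * θ * Complex.I), 0, 1])

/-- The `(2,3,1)` operator of type III. -/
noncomputable def RIII (θ : ℝ) : MIM 2 3 :=
  ofMat8 <| ((Real.sqrt 2 : ℂ))⁻¹ •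
    (Matrix.reindex finSumFinEquiv finSumFinEquiv <| Matrix.fromBlocks
      !![1, 0, 1, 0;
         0, 1, 0, Complex.exp (θ * Complex.I);
         -1, 0, 1, 0;
         0, -Complex.exp (-θ * Complex.I), 0, 1] 0 0
      !![1, 0, -Complex.exp (θ * Complex.I), 0;
         0, 1, 0, -Complex.exp (2 * θ * Complex.I);
         Complex.exp (-θ * Complex.I), 0, 1, 0;
         0, Complex.exp (-2 * θ * Complex.I), 0, 1])

/-- The `4×4` antidiagonal matrix `J`. -/
def Jmat : Matrix (Fin 4) (Fin 4) ℂ :=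
  !![0, 0, 0, 1;
     0, 0, 1, 0;
     0, 1, 0, 0;
     1, 0, 0, 0]

/-- The `(2,3,2)` operator of Rowell–Zhang–Wu–Ge. -/
noncomputable def R232 : MIM 2 3 :=
  ofMat8 <| ((Real.sqrt 2 : ℂ))⁻¹ •
    (Matrix.reindex finSumFinEquiv finSumFinEquiv <|
      Matrix.fromBlocks 1 Jmat (-Jmat) 1)

section SiteOperators

variable {ι α : Type*} [Fintype ι] [DecidableEq ι] [Fintype α] [DecidableEq α]

/-- The operator on configurations `ι → α` that changes only the value at site `p`;
`F a s` is the coefficient of the transition from `a` to `Function.update a p s`. -/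
def siteOp (p : ι) (F : (ι → α) → α → ℂ) : Matrix (ι → α) (ι → α) ℂ :=
  fun a b => if b = Function.update a p (b p) then F a (b p) else 0

theorem siteOp_mul_apply (p : ι) (F : (ι → α) → α → ℂ) (M : Matrix (ι → α) (ι → α) ℂ)
    (a b : ι → α) :
    (siteOp p F * M) a b = ∑ s, F a s * M (Function.update a p s) b := by
  rw [Matrix.mul_apply]
  symm
  apply Finset.sum_of_injOn (fun s => Function.update a p s)
  · exact (Function.update_injective a p).injOn
  · simp
  · intro c _ hc
    have h : c ≠ Function.update a p (c p) := fun h => hc ⟨c p, by simp, h.symm⟩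
    simp [siteOp, h]
  · intro s _
    simp [siteOp]

theorem siteOp_commute {p q : ι} (hpq : p ≠ q) {F G : (ι → α) → α → ℂ}
    (hF : ∀ a s t, F (Function.update a q t) s = F a s)
    (hG : ∀ a s t, G (Function.update a p t) s = G a s) :
    Commute (siteOp p F) (siteOp q G) := by
  ext a b
  rw [← mul_one (siteOp q G), ← mul_one (siteOp p F)]
  simp only [mul_assoc, one_mul]
  simp only [siteOp_mul_apply, hF, hG, Finset.mul_sum]
  rw [Finset.sum_comm]
  refine Finset.sum_congr rfl fun s _ => Finset.sum_congr rfl fun t _ => ?_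
  rw [Function.update_comm hpq]
  ring

/-- The braid relation for two neighbouring inner sites of a chain of four reduces to a scalar
identity between the transition coefficients. -/
theorem siteOp_braid {w : α → α → α → α → ℂ}
    (hw : ∀ a b c d r t, ∑ s, w a c b s * w s d c t * w a t s r =
      ∑ s, w b d c s * w a s b r * w r d s t) :
    siteOp (1 : Fin 4) (fun a s => w (a 0) (a 2) (a 1) s) *
      siteOp (2 : Fin 4) (fun a s => w (a 1) (a 3) (a 2) s) *
      siteOp (1 : Fin 4) (fun a s => w (a 0) (a 2) (a 1) s) =
    siteOp (2 : Fin 4) (fun a s => w (a 1) (a 3) (a 2) s) *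
      siteOp (1 : Fin 4) (fun a s => w (a 0) (a 2) (a 1) s) *
      siteOp (2 : Fin 4) (fun a s => w (a 1) (a 3) (a 2) s) := by
  ext a b
  rw [← mul_one (siteOp (1 : Fin 4) _ * _ * _), ← mul_one (siteOp (2 : Fin 4) _ * _ * _)]
  have h12 : (1 : Fin 4) ≠ 2 := by decide
  have hl (s t r : α) : Function.update (Function.update (Function.update a 1 s) 2 t) 1 r =
      Function.update (Function.update a 1 r) 2 t := by
    rw [Function.update_comm h12.symm, Function.update_idem]
  have hr (s t r : α) : Function.update (Function.update (Function.update a 2 s) 1 r) 2 t =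
      Function.update (Function.update a 1 r) 2 t := by
    rw [Function.update_comm h12, Function.update_idem, Function.update_comm h12]
  simp only [mul_assoc, siteOp_mul_apply, Matrix.one_apply, hl, hr]
  simp only [Function.update_apply, Finset.mul_sum, Fin.reduceEq, if_true, if_false]
  have h := fun r t => congrArg
    (· * if Function.update (Function.update a 1 r) 2 t = b then (1 : ℂ) else 0)
    (hw (a 0) (a 1) (a 2) (a 3) r t)
  simp only [Finset.sum_mul, mul_assoc] at h
  trans ∑ r, ∑ t, ∑ s, w (a 0) (a 2) (a 1) s * (w s (a 3) (a 2) t * (w (a 0) t s r *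
    if Function.update (Function.update a 1 r) 2 t = b then 1 else 0))
  · rw [Finset.sum_comm_cycle]
    exact Finset.sum_congr rfl fun r _ => Finset.sum_comm
  · simp only [h]
    rw [Finset.sum_comm_cycle, Finset.sum_comm_cycle]

end SiteOperators

/-- The `2 × 2` matrix by which, up to `1 / √2`, the type I operator acts on the middle tensor
factor when the outer factors are in the basis states `x` and `y`; `u` stands for `exp (iθ)`. -/
noncomputable def middleBlock (u : ℂ) (x y : Fin 2) : Matrix (Fin 2) (Fin 2) ℂ :=
  ![![!![1, 1; -Complex.I, Complex.I], !![Complex.I, u; -Complex.I * u⁻¹, 1]],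
    ![!![Complex.I, u; -Complex.I * u⁻¹, 1],
      !![1, -u ^ 2; Complex.I * u⁻¹ ^ 2, Complex.I]]] x y

/-- `middleBlock` with its normalization. -/
noncomputable def middleCoeff (θ : ℝ) (x y s t : Fin 2) : ℂ :=
  (Real.sqrt 2 : ℂ)⁻¹ * middleBlock (Complex.exp (θ * Complex.I)) x y s t

theorem RI_apply (θ : ℝ) (a b : Fin 3 → Fin 2) :
    RI θ a b = if a 0 = b 0 ∧ a 2 = b 2 then middleCoeff θ (a 0) (a 2) (a 1) (b 1) else 0 := by
  have h1 : Complex.exp (-θ * Complex.I) = (Complex.exp (θ * Complex.I))⁻¹ := by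
    rw [← Complex.exp_neg, neg_mul]
  have h2 : Complex.exp (2 * θ * Complex.I) = Complex.exp (θ * Complex.I) ^ 2 := by
    rw [← Complex.exp_nat_mul]; congr 1; push_cast; ring
  have h3 : Complex.exp (-2 * θ * Complex.I) = (Complex.exp (θ * Complex.I))⁻¹ ^ 2 := by
    rw [← Complex.exp_neg, ← Complex.exp_nat_mul]; congr 1; push_cast; ring
  have hs (v : Fin 3 → Fin 2) : finSumFinEquiv.symm (emb v : Fin (4 + 4)) =
      (![Sum.inl, Sum.inr] (v 0)) (![![0, 1], ![2, 3]] (v 1) (v 2) : Fin 4) := by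
    rw [Equiv.symm_apply_eq]
    revert v
    decide
  simp only [RI, ofMat8, middleCoeff, Matrix.smul_apply, Matrix.reindex_apply,
    Matrix.submatrix_apply, hs, h1, h2, h3, middleBlock, smul_eq_mul]
  generalize a 0 = a0
  generalize a 1 = a1
  generalize a 2 = a2
  generalize b 0 = b0
  generalize b 1 = b1
  generalize b 2 = b2
  fin_cases a0 <;> fin_cases b0 <;> fin_cases a2 <;> fin_cases b2 <;>
    fin_cases a1 <;> fin_cases b1 <;> simp

theorem RI_eq_siteOp (θ : ℝ) :
    RI θ = siteOp 1 fun a s => middleCoeff θ (a 0) (a 2) (a 1) s := by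
  ext a b
  rw [RI_apply]
  refine if_congr ?_ rfl rfl
  simp [Function.eq_update_iff, Fin.forall_fin_succ, eq_comm]

theorem Rop_RI_eq_siteOp (θ : ℝ) (n : ℕ) (i : Fin (n - 1)) (h : (i : ℕ) + 2 < 3 + 1 * (n - 2)) :
    Rop 2 3 1 n (RI θ) i = siteOp ⟨i + 1, by omega⟩
      (fun a s => middleCoeff θ (a ⟨i, by omega⟩) (a ⟨i + 2, h⟩) (a ⟨i + 1, by omega⟩) s) := by
  ext a b
  simp only [Rop, siteOp, RI_apply, ← ite_and]
  simp only [one_mul, Fin.val_zero, Fin.val_one, Fin.val_two, add_zero]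
  refine if_congr ?_ rfl rfl
  rw [Function.eq_update_iff]
  constructor
  · rintro ⟨hout, h0, h2⟩
    refine ⟨rfl, fun x hx => ?_⟩
    have hx' : (x : ℕ) ≠ i + 1 := fun h => hx (Fin.ext h)
    by_cases hx0 : (x : ℕ) = i
    · convert h0.symm
    by_cases hx2 : (x : ℕ) = i + 2
    · convert h2.symm
    exact (hout x (by omega)).symm
  · rintro ⟨-, hx⟩
    exact ⟨fun x hx' => (hx x fun h => by simp [Fin.ext_iff] at h; omega).symm,
      (hx _ (by simp)).symm, (hx _ (by simp)).symm⟩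

theorem middleCoeff_mul_star (θ : ℝ) (x y s t : Fin 2) :
    ∑ r, middleCoeff θ x y s r * star (middleCoeff θ x y t r) = if s = t then 1 else 0 := by
  have hc : (Real.sqrt 2 : ℂ)⁻¹ * (Real.sqrt 2 : ℂ)⁻¹ = 2⁻¹ := by
    rw [← mul_inv, ← Complex.ofReal_mul, Real.mul_self_sqrt (by norm_num)]; norm_num
  have hu : (starRingEnd ℂ) (Complex.exp (θ * Complex.I)) = (Complex.exp (θ * Complex.I))⁻¹ := by
    rw [← Complex.exp_conj, ← Complex.exp_neg]; simp
  have h0 := Complex.exp_ne_zero (θ * Complex.I)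
  have hI := Complex.I_mul_I
  simp only [middleCoeff, middleBlock]
  generalize Complex.exp (θ * Complex.I) = u at *
  have hv : u * u⁻¹ = 1 := mul_inv_cancel₀ h0
  generalize hw : u⁻¹ = v at *
  have hvc : (starRingEnd ℂ) v = u := by rw [← hu]; simp
  generalize hd : (Real.sqrt 2 : ℂ)⁻¹ = c at *
  have hcc : (starRingEnd ℂ) c = c := by rw [← hd]; simp
  fin_cases x <;> fin_cases y <;> fin_cases s <;> fin_cases t <;>
    simp [Fin.sum_univ_two, hu, hvc, hcc] <;> grind

theorem middleBlock_braid {u : ℂ} (h0 : u ≠ 0) (a b c d r t : Fin 2) :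
    ∑ s, middleBlock u a c b s * middleBlock u s d c t * middleBlock u a t s r =
      ∑ s, middleBlock u b d c s * middleBlock u a s b r * middleBlock u r d s t := by
  have hv : u * u⁻¹ = 1 := mul_inv_cancel₀ h0
  have hI := Complex.I_mul_I
  simp only [middleBlock]
  generalize u⁻¹ = v at *
  generalize Complex.I = i at *
  fin_cases a <;> fin_cases b <;> fin_cases c <;> fin_cases d <;> fin_cases r <;> fin_cases t <;>
    simp [Fin.sum_univ_two] <;> grind

theorem RI_mem_unitaryGroup (θ : ℝ) : RI θ ∈ Matrix.unitaryGroup (Fin 3 → Fin 2) ℂ := by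
  rw [Matrix.mem_unitaryGroup_iff]
  ext a b
  conv_lhs => rw [RI_eq_siteOp, siteOp_mul_apply, ← RI_eq_siteOp]
  simp only [Matrix.star_apply, RI_apply]
  by_cases h : b 0 = a 0 ∧ b 2 = a 2
  · have hab : a = b ↔ a 1 = b 1 := by
      simp [funext_iff, Fin.forall_fin_succ, h]
    simpa [h, Matrix.one_apply, hab] using middleCoeff_mul_star θ (a 0) (a 2) (a 1) (b 1)
  · have hab : a ≠ b := by rintro rfl; simp at h
    simp [h, hab]

theorem RI_braid (θ : ℝ) :
    Rop 2 3 1 3 (RI θ) 0 * Rop 2 3 1 3 (RI θ) 1 * Rop 2 3 1 3 (RI θ) 0 =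
      Rop 2 3 1 3 (RI θ) 1 * Rop 2 3 1 3 (RI θ) 0 * Rop 2 3 1 3 (RI θ) 1 := by
  rw [Rop_RI_eq_siteOp θ 3 0 (by simp), Rop_RI_eq_siteOp θ 3 1 (by simp)]
  refine siteOp_braid fun a b c d r t => ?_
  have h := middleBlock_braid (Complex.exp_ne_zero (θ * Complex.I)) a b c d r t
  simp only [Fin.sum_univ_two] at h
  simp only [middleCoeff, Fin.sum_univ_two]
  linear_combination (Real.sqrt 2 : ℂ)⁻¹ ^ 3 * h

theorem RI_far_commute (θ : ℝ) (j : ℕ) (hj : 4 ≤ j) :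
    Commute (Rop 2 3 1 j (RI θ) ⟨0, by omega⟩) (Rop 2 3 1 j (RI θ) ⟨j - 2, by omega⟩) := by
  rw [Rop_RI_eq_siteOp θ j _ (by simp; omega), Rop_RI_eq_siteOp θ j _ (by simp; omega)]
  apply siteOp_commute
  · simp [Fin.ext_iff]; omega
  · intro a s t
    simp only [Function.update_apply, Fin.ext_iff]
    grind
  · intro a s t
    simp only [Function.update_apply, Fin.ext_iff]
    grind

theorem stmt11 (θ : ℝ) :
    RI θ ∈ Matrix.unitaryGroup (Fin 3 → Fin 2) ℂ ∧ IsGYB 2 3 1 (RI θ) :=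
  ⟨RI_mem_unitaryGroup θ, (Unitary.toUnits ⟨RI θ, RI_mem_unitaryGroup θ⟩).isUnit,
    RI_braid θ, RI_far_commute θ⟩
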